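/- Under the hypotheses of the previous statement (Z ∈ C¹([S,T]; L^{p,q}_F(S,T;H)), Diag[Z] defined via Diag[Z](s) = Z(S,s) + ∫_S^s ∂_t Z(τ,s) dτ), for any 1 ≤ p' ≤ p and 1 ≤ q' ≤ q and every t ∈ [S,T): E[(∫_t^{t+ε} |Z(t,s) − Diag[Z](s)|^{q'} ds)^{p'/q'}]^{1/p'} = o(ε^{1 + 1/q' − 1/q}) as ε ↓ 0. In particular (p' = q' = 1), Diag[Z] is the unique process satisfying Property (D) with respect to Z. -/

import Mathlib

open MeasureTheory Filter Set ENNReal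
open scoped Topology

noncomputable section

/-- The `L^{p,q}` norm `E[(∫_A |z(s)|^q ds)^{p/q}]^{1/p}` over a set `A ⊆ ℝ` (in `ℝ≥0∞`). -/
def LpqNormOn {Ω : Type*} [MeasurableSpace Ω] (P : Measure Ω) (A : Set ℝ) (p q : ℝ)
    {n : ℕ} (z : ℝ → Ω → EuclideanSpace ℝ (Fin n)) : ℝ≥0∞ :=
  (∫⁻ ω, (∫⁻ s in A, (ENNReal.ofReal ‖z s ω‖) ^ q ∂volume) ^ (p/q) ∂P) ^ (1/p)


/-- **Minkowski's integral inequality** for a finite measure. -/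
theorem eLpNorm'_lintegral_le {α β : Type*} [MeasurableSpace α] [MeasurableSpace β]
    (κ : Measure α) [SFinite κ] (ν : Measure β) [IsFiniteMeasure ν] {p : ℝ} (hp : 1 ≤ p)
    {f : α → β → ℝ≥0∞} (hf : Measurable (Function.uncurry f)) :
    eLpNorm' (fun y => ∫⁻ x, f x y ∂κ) p ν ≤ ∫⁻ x, eLpNorm' (f x) p ν ∂κ := by
  simp only [eLpNorm'_eq_lintegral_enorm, enorm_eq_self]
  have hfy (y : β) : Measurable fun x => f x y := hf.comp measurable_prodMk_right
  have hfx (x : α) : Measurable (f x) := hf.comp measurable_prodMk_left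
  rcases hp.eq_or_lt with rfl | hp1
  · simp only [ENNReal.rpow_one, div_one]
    rw [lintegral_lintegral_swap hf.aemeasurable]
  have hp0 : 0 < p := by linarith
  have hpq := Real.HolderConjugate.conjExponent hp1
  set q := p.conjExponent
  set C := ∫⁻ x, (∫⁻ y, f x y ^ p ∂ν) ^ (1 / p) ∂κ
  set G : β → ℝ≥0∞ := fun y => ∫⁻ x, f x y ∂κ
  have hG : Measurable G := hf.lintegral_prod_left'
  set I : ℕ → ℝ≥0∞ := fun N => ∫⁻ y, (min (G y) N) ^ p ∂ν
  have hGN (N : ℕ) : Measurable fun y => min (G y) (N : ℝ≥0∞) := hG.min measurable_const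
  have hbound (N : ℕ) : I N ≤ C ^ p := by
    have hfin : I N ≠ ⊤ := by
      refine ((lintegral_mono (g := fun _ => (N : ℝ≥0∞) ^ p) fun y => ?_).trans_lt ?_).ne
      · exact ENNReal.rpow_le_rpow (min_le_right _ _) hp0.le
      · rw [lintegral_const]
        exact ENNReal.mul_lt_top (ENNReal.rpow_lt_top_of_nonneg hp0.le (by simp))
          (measure_lt_top _ _)
    have hle : I N ≤ C * I N ^ (1 / q) := by
      calc I N ≤ ∫⁻ y, ∫⁻ x, f x y * (min (G y) N) ^ (p - 1) ∂κ ∂ν := by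
            refine lintegral_mono fun y => ?_
            rw [lintegral_mul_const _ (hfy y)]
            calc (min (G y) N) ^ p = (min (G y) N) ^ (1 + (p - 1)) := by ring_nf
              _ = min (G y) N * (min (G y) N) ^ (p - 1) := by
                rw [ENNReal.rpow_add_of_nonneg _ _ zero_le_one (by linarith), ENNReal.rpow_one]
              _ ≤ _ := by gcongr; exact min_le_left _ _
        _ = ∫⁻ x, ∫⁻ y, f x y * (min (G y) N) ^ (p - 1) ∂ν ∂κ := by
            rw [lintegral_lintegral_swap]
            exact ((hf.comp measurable_swap).mul
              (((hGN N).comp measurable_fst).pow_const _)).aemeasurable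
        _ ≤ ∫⁻ x, (∫⁻ y, f x y ^ p ∂ν) ^ (1 / p) * I N ^ (1 / q) ∂κ :=
            lintegral_mono fun x =>
              ENNReal.lintegral_mul_rpow_le_lintegral_rpow_mul_lintegral_rpow hpq
                (hfx x).aemeasurable (hGN N).aemeasurable
        _ = C * I N ^ (1 / q) := by
            rw [lintegral_mul_const]
            exact (hf.pow_const p).lintegral_prod_right'.pow_const _
    by_cases h0 : I N = 0
    · rw [h0]; exact zero_le
    have hsum : 1 / p + 1 / q = 1 := by simpa using hpq.inv_add_inv_eq_one
    have h1 : I N ^ (1 / p) ≤ C := by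
      have h2 : I N ^ (1 / p) * I N ^ (1 / q) ≤ C * I N ^ (1 / q) := by
        rwa [← ENNReal.rpow_add _ _ h0 hfin, hsum, ENNReal.rpow_one]
      refine (ENNReal.mul_le_mul_iff_left ?_ ?_).1 h2
      · simp [h0, hfin]
      · exact ENNReal.rpow_ne_top_of_nonneg (one_div_nonneg.2 hpq.symm.nonneg) hfin
    calc I N = (I N ^ (1 / p)) ^ p := by
          rw [← ENNReal.rpow_mul, one_div_mul_cancel hp0.ne', ENNReal.rpow_one]
      _ ≤ C ^ p := ENNReal.rpow_le_rpow h1 hp0.le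
  have hsup : ∫⁻ y, G y ^ p ∂ν = ⨆ N, I N := by
    rw [← lintegral_iSup (fun N => (hGN N).pow_const p)]
    · refine lintegral_congr fun y => ?_
      have : G y = ⨆ N : ℕ, min (G y) (N : ℝ≥0∞) := by
        rw [← inf_iSup_eq, ENNReal.iSup_natCast, inf_top_eq]
      conv_lhs => rw [this]
      exact (ENNReal.orderIsoRpow p hp0).map_iSup _
    · intro N M h y
      exact ENNReal.rpow_le_rpow (min_le_min_left _ (by exact_mod_cast h)) hp0.le
  calc (∫⁻ y, G y ^ p ∂ν) ^ (1 / p) ≤ (C ^ p) ^ (1 / p) := by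
        rw [hsup]
        exact ENNReal.rpow_le_rpow (iSup_le hbound) (one_div_nonneg.2 hp0.le)
    _ = C := by rw [← ENNReal.rpow_mul, mul_one_div_cancel hp0.ne', ENNReal.rpow_one]

/-- If the right averages of an integrable function vanish in the limit at every point of
`[a, b)`, then the function has zero integral over `[a, b]`. -/
theorem setLIntegral_eq_zero_of_tendsto_right_average {g : ℝ → ℝ≥0∞} (hg : Measurable g)
    {a b : ℝ} (hab : a ≤ b) (hfin : ∫⁻ s in Icc a b, g s ≠ ⊤)
    (h : ∀ t ∈ Ico a b, Tendsto (fun ε : ℝ => (ENNReal.ofReal ε)⁻¹ * ∫⁻ s in Icc t (t + ε), g s)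
      (𝓝[>] 0) (𝓝 0)) :
    ∫⁻ s in Icc a b, g s = 0 := by
  have hint : IntegrableOn (fun s => (g s).toReal) (Icc a b) :=
    integrable_toReal_of_lintegral_ne_top hg.aemeasurable hfin
  have hval {x y : ℝ} (hx : x ∈ Icc a b) (hy : y ∈ Icc a b) (hxy : x ≤ y) :
      ∫ s in x..y, (g s).toReal = (∫⁻ s in Icc x y, g s).toReal := by
    rw [intervalIntegral.integral_of_le hxy, ← integral_Icc_eq_integral_Ioc,
      integral_toReal hg.aemeasurable]
    exact ae_lt_top hg (ne_top_of_le_ne_top hfin (lintegral_mono_set (Icc_subset_Icc hx.1 hy.2)))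
  have hii {x y : ℝ} (hx : x ∈ Icc a b) (hy : y ∈ Icc a b) :
      IntervalIntegrable (fun s => (g s).toReal) volume x y := by
    refine (hint.mono_set ?_).intervalIntegrable
    exact uIcc_subset_Icc hx hy
  have hcont : ContinuousOn (fun x => ∫ s in a..x, (g s).toReal) (Icc a b) := by
    have := intervalIntegral.continuousOn_primitive_interval (a := a) (b := b)
      (f := fun s => (g s).toReal) (μ := volume) (by rwa [uIcc_of_le hab])
    rwa [uIcc_of_le hab] at this
  have hderiv : ∀ x ∈ Ico a b,
      HasDerivWithinAt (fun x => ∫ s in a..x, (g s).toReal) 0 (Ici x) x := by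
    intro x hx
    rw [hasDerivWithinAt_iff_tendsto_slope, Ici_sdiff_left]
    have h1 : Tendsto (fun y => ((ENNReal.ofReal (y - x))⁻¹ *
        ∫⁻ s in Icc x (x + (y - x)), g s).toReal) (𝓝[>] x) (𝓝 0) := by
      refine (ENNReal.tendsto_toReal ENNReal.zero_ne_top).comp ((h x hx).comp ?_)
      refine tendsto_nhdsWithin_iff.2 ⟨?_, ?_⟩
      · refine Tendsto.mono_left ?_ nhdsWithin_le_nhds
        exact (by fun_prop : Continuous fun y : ℝ => y - x).tendsto' _ _ (sub_self x)
      · filter_upwards [self_mem_nhdsWithin] with y hy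
        exact sub_pos.2 (mem_Ioi.1 hy)
    refine h1.congr' ?_
    filter_upwards [Ioo_mem_nhdsGT hx.2] with y hy
    have hxm : x ∈ Icc a b := ⟨hx.1, hx.2.le⟩
    have hym : y ∈ Icc a b := ⟨hx.1.trans hy.1.le, hy.2.le⟩
    have ham : a ∈ Icc a b := left_mem_Icc.2 hab
    rw [slope_def_field, intervalIntegral.integral_interval_sub_left (hii ham hym) (hii ham hxm),
      hval hxm hym hy.1.le, ENNReal.toReal_mul, ENNReal.toReal_inv,
      ENNReal.toReal_ofReal (sub_pos.2 hy.1).le, add_sub_cancel, inv_mul_eq_div]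
  have := constant_of_has_deriv_right_zero hcont hderiv b (right_mem_Icc.2 hab)
  simp only [intervalIntegral.integral_same] at this
  rw [hval (left_mem_Icc.2 hab) (right_mem_Icc.2 hab) hab, ENNReal.toReal_eq_zero_iff] at this
  exact this.resolve_right hfin

/-- The mixed norm `‖ω ↦ ‖f(·, ω)‖_{L^q(μ)}‖_{L^p(P)}` of a nonnegative function. -/
def mixedNorm {α Ω : Type*} [MeasurableSpace α] [MeasurableSpace Ω] (μ : Measure α)
    (P : Measure Ω) (p q : ℝ) (f : α → Ω → ℝ≥0∞) : ℝ≥0∞ :=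
  eLpNorm' (fun ω => eLpNorm' (fun s => f s ω) q μ) p P

section mixedNorm

variable {α β Ω : Type*} [MeasurableSpace α] [MeasurableSpace β] [MeasurableSpace Ω]
  {μ : Measure α} {P : Measure Ω} {p q : ℝ}

theorem measurable_eLpNorm'_left [SFinite μ] {f : α → Ω → ℝ≥0∞}
    (hf : Measurable (Function.uncurry f)) :
    Measurable fun ω => eLpNorm' (fun s => f s ω) q μ := by
  simp only [eLpNorm'_eq_lintegral_enorm, enorm_eq_self]
  exact (hf.pow_const q).lintegral_prod_left'.pow_const _

theorem mixedNorm_mono_ae (hp : 0 ≤ p) (hq : 0 ≤ q) {f g : α → Ω → ℝ≥0∞}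
    (h : ∀ᵐ ω ∂P, ∀ᵐ s ∂μ, f s ω ≤ g s ω) : mixedNorm μ P p q f ≤ mixedNorm μ P p q g := by
  refine eLpNorm'_mono_enorm_ae hp ?_
  filter_upwards [h] with ω hω
  exact eLpNorm'_mono_enorm_ae hq hω

theorem mixedNorm_mono_measure (hp : 0 ≤ p) (hq : 0 ≤ q) {ν : Measure α} (h : μ ≤ ν)
    (f : α → Ω → ℝ≥0∞) : mixedNorm μ P p q f ≤ mixedNorm ν P p q f :=
  eLpNorm'_mono_enorm_ae hp <| ae_of_all _ fun _ => eLpNorm'_mono_measure _ h hq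

theorem mixedNorm_add_le [SFinite μ] (hp : 1 ≤ p) (hq : 1 ≤ q) {f g : α → Ω → ℝ≥0∞}
    (hf : Measurable (Function.uncurry f)) (hg : Measurable (Function.uncurry g)) :
    mixedNorm μ P p q (fun s ω => f s ω + g s ω) ≤ mixedNorm μ P p q f + mixedNorm μ P p q g := by
  refine le_trans ?_ (eLpNorm'_add_le (measurable_eLpNorm'_left hf).aestronglyMeasurable
    (measurable_eLpNorm'_left hg).aestronglyMeasurable hp)
  refine eLpNorm'_mono_enorm_ae (by linarith) <| ae_of_all _ fun ω => ?_
  exact eLpNorm'_add_le (hf.comp measurable_prodMk_right).aestronglyMeasurable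
    (hg.comp measurable_prodMk_right).aestronglyMeasurable hq

theorem mixedNorm_lintegral_le [IsFiniteMeasure μ] [IsFiniteMeasure P] (κ : Measure β) [SFinite κ]
    (hp : 1 ≤ p) (hq : 1 ≤ q) {f : β → α → Ω → ℝ≥0∞}
    (hf : Measurable fun x : (β × α) × Ω => f x.1.1 x.1.2 x.2) :
    mixedNorm μ P p q (fun s ω => ∫⁻ τ, f τ s ω ∂κ) ≤ ∫⁻ τ, mixedNorm μ P p q (f τ) ∂κ := by
  have hinner : Measurable (Function.uncurry fun τ ω => eLpNorm' (fun s => f τ s ω) q μ) :=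
    measurable_eLpNorm'_left (f := fun s (x : β × Ω) => f x.1 s x.2)
      (hf.comp (by fun_prop : Measurable fun x : α × β × Ω => ((x.2.1, x.1), x.2.2)))
  refine le_trans ?_ (eLpNorm'_lintegral_le κ P hp hinner)
  refine eLpNorm'_mono_enorm_ae (by linarith) <| ae_of_all _ fun ω => ?_
  exact eLpNorm'_lintegral_le κ μ hq (hf.comp measurable_prodMk_right)

theorem mixedNorm_le_of_exponent_le [SFinite μ] [IsProbabilityMeasure P] {p' q' : ℝ} (hp' : 0 < p')
    (hp : p' ≤ p) (hq' : 0 < q') (hq : q' ≤ q) {f : α → Ω → ℝ≥0∞}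
    (hf : Measurable (Function.uncurry f)) :
    mixedNorm μ P p' q' f ≤ μ univ ^ (1 / q' - 1 / q) * mixedNorm μ P p q f := by
  have hm := measurable_eLpNorm'_left (μ := μ) (q := q) hf
  have hexp : 0 ≤ 1 / q' - 1 / q := sub_nonneg.2 (one_div_le_one_div_of_le hq' hq)
  calc mixedNorm μ P p' q' f
      ≤ eLpNorm' (fun ω => μ univ ^ (1 / q' - 1 / q) * eLpNorm' (fun s => f s ω) q μ) p' P := by
        refine eLpNorm'_mono_enorm_ae hp'.le <| ae_of_all _ fun ω => ?_
        simp only [enorm_eq_self]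
        rw [mul_comm]
        exact eLpNorm'_le_eLpNorm'_mul_rpow_measure_univ hq' hq
          (hf.comp measurable_prodMk_right).aestronglyMeasurable
    _ ≤ eLpNorm' (fun ω => μ univ ^ (1 / q' - 1 / q) * eLpNorm' (fun s => f s ω) q μ) p P :=
        eLpNorm'_le_eLpNorm'_of_exponent_le hp' hp P (hm.const_mul _).aestronglyMeasurable
    _ = _ := by
        simp only [mixedNorm, eLpNorm'_eq_lintegral_enorm _ p, enorm_eq_self]
        have hp0 : 0 < p := hp'.trans_le hp
        simp_rw [ENNReal.mul_rpow_of_nonneg _ _ hp0.le]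
        rw [lintegral_const_mul _ (hm.pow_const p), ENNReal.mul_rpow_of_nonneg _ _ (by positivity),
          ← ENNReal.rpow_mul _ p, mul_one_div_cancel hp0.ne', ENNReal.rpow_one]

theorem tendsto_mixedNorm_restrict_zero {ι : Type*} {l : Filter ι} [l.IsCountablyGenerated]
    [SFinite μ] (hp : 0 < p) (hq : 0 < q) {f : α → Ω → ℝ≥0∞} (hf : Measurable (Function.uncurry f))
    (hfin : mixedNorm μ P p q f ≠ ⊤) {s : ι → Set α} (hs : Tendsto (fun i => μ (s i)) l (𝓝 0)) :
    Tendsto (fun i => mixedNorm (μ.restrict (s i)) P p q f) l (𝓝 0) := by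
  have hlt : ∫⁻ ω, eLpNorm' (fun s => f s ω) q μ ^ p ∂P ≠ ⊤ := by
    simpa [mixedNorm, eLpNorm'_eq_lintegral_enorm _ p, ENNReal.rpow_eq_top_iff_of_pos,
      hp, hp.le] using hfin
  have hmain : Tendsto (fun i => ∫⁻ ω, eLpNorm' (fun s => f s ω) q (μ.restrict (s i)) ^ p ∂P) l
      (𝓝 (∫⁻ _, 0 ∂P)) := by
    refine tendsto_lintegral_filter_of_dominated_convergence
      (fun ω => eLpNorm' (fun s => f s ω) q μ ^ p) ?_ ?_ hlt ?_
    · exact Eventually.of_forall fun i => (measurable_eLpNorm'_left hf).pow_const p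
    · exact Eventually.of_forall fun i => ae_of_all _ fun ω =>
        ENNReal.rpow_le_rpow (eLpNorm'_mono_measure _ Measure.restrict_le_self hq.le) hp.le
    · filter_upwards [ae_lt_top ((measurable_eLpNorm'_left hf).pow_const p) hlt] with ω hω
      have hω' : ∫⁻ s, f s ω ^ q ∂μ ≠ ⊤ := by
        simpa [eLpNorm'_eq_lintegral_enorm, ENNReal.rpow_eq_top_iff_of_pos, hp, hq,
          hp.le, hq.le, lt_top_iff_ne_top] using hω
      have h0 := tendsto_setLIntegral_zero hω' hs
      have h1 := (h0.ennrpow_const (1 / q)).ennrpow_const p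
      simpa [eLpNorm'_eq_lintegral_enorm, hq, hp] using h1
  have := hmain.ennrpow_const (1 / p)
  simpa [mixedNorm, eLpNorm'_eq_lintegral_enorm _ p, hp] using this

theorem mixedNorm_one_one (f : α → Ω → ℝ≥0∞) :
    mixedNorm μ P 1 1 f = ∫⁻ ω, ∫⁻ s, f s ω ∂μ ∂P := by
  simp [mixedNorm, eLpNorm'_eq_lintegral_enorm]

end mixedNorm

theorem ae_enorm_sub_diag_le {Ω E : Type*} [MeasurableSpace Ω] {P : Measure Ω} [SFinite P]
    [NormedAddCommGroup E] [NormedSpace ℝ E] {S T : ℝ} {Z dZ : ℝ → ℝ → Ω → E} {Diag : ℝ → Ω → E}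
    {a b t : ℝ} (ht : t ∈ Icc a b) (hab : Icc a b ⊆ Icc S T)
    (h : ∀ᵐ x ∂((volume.restrict (Icc S T)).prod P), x.1 ∈ Icc S T ∧
      Diag x.1 x.2 = Z t x.1 x.2 + ∫ τ in t..x.1, dZ τ x.1 x.2) :
    ∀ᵐ ω ∂P, ∀ᵐ s ∂(volume.restrict (Icc a b)),
      ‖Z t s ω - Diag s ω‖ₑ ≤ ∫⁻ τ in Icc a b, ‖dZ τ s ω‖ₑ := by
  have hswap := Measure.ae_ae_of_ae_prod
    ((Measure.measurePreserving_swap (μ := P)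
      (ν := volume.restrict (Icc S T))).quasiMeasurePreserving.ae h)
  filter_upwards [hswap] with ω hω
  filter_upwards [ae_restrict_of_ae_restrict_of_subset hab hω,
    ae_restrict_mem measurableSet_Icc] with s hs hsm
  simp only [Prod.swap_prod_mk] at hs
  rw [hs.2, sub_add_cancel_left, enorm_neg, ← ofReal_norm,
    intervalIntegral.norm_integral_eq_norm_integral_uIoc, ofReal_norm]
  exact (enorm_integral_le_lintegral_enorm _).trans
    (lintegral_mono_set (uIoc_subset_uIcc.trans (uIcc_subset_Icc ht hsm)))

theorem measurable_lintegral_enorm_derivative {Ω E : Type*} [MeasurableSpace Ω]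
    [NormedAddCommGroup E] [MeasurableSpace E] [BorelSpace E] {dZ : ℝ → ℝ → Ω → E}
    (hmeas : Measurable fun x : (ℝ × ℝ) × Ω => dZ x.1.1 x.1.2 x.2) (A : Set ℝ) :
    Measurable fun x : ℝ × Ω => ∫⁻ τ in A, ‖dZ τ x.1 x.2‖ₑ :=
  Measurable.lintegral_prod_left' (f := fun z : ℝ × (ℝ × Ω) => ‖dZ z.1 z.2.1 z.2.2‖ₑ)
    (hmeas.comp (by fun_prop : Measurable fun z : ℝ × (ℝ × Ω) => ((z.1, z.2.1), z.2.2))).enorm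

section FlowDerivative

variable {Ω E : Type*} [MeasurableSpace Ω] {P : Measure Ω}
  [NormedAddCommGroup E] [MeasurableSpace E] [BorelSpace E]
  [SecondCountableTopology E] {S T p q : ℝ} {Z dZ : ℝ → ℝ → Ω → E}

theorem mixedNorm_enorm_le_add (hp : 1 ≤ p) (hq : 1 ≤ q) (A : Set ℝ)
    (hmeas : Measurable fun x : (ℝ × ℝ) × Ω => dZ x.1.1 x.1.2 x.2) (τ τ₀ : ℝ) :
    mixedNorm (volume.restrict A) P p q (fun s ω => ‖dZ τ s ω‖ₑ) ≤
      mixedNorm (volume.restrict A) P p q (fun s ω => ‖dZ τ s ω - dZ τ₀ s ω‖ₑ) +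
      mixedNorm (volume.restrict A) P p q (fun s ω => ‖dZ τ₀ s ω‖ₑ) := by
  have hm (σ : ℝ) : Measurable fun x : ℝ × Ω => dZ σ x.1 x.2 :=
    hmeas.comp (by fun_prop : Measurable fun x : ℝ × Ω => ((σ, x.1), x.2))
  refine le_trans ?_ (mixedNorm_add_le hp hq ((hm τ).sub (hm τ₀)).enorm (hm τ₀).enorm)
  refine mixedNorm_mono_ae (by linarith) (by linarith) <|
    ae_of_all _ fun ω => ae_of_all _ fun s => ?_
  simpa using enorm_add_le (dZ τ s ω - dZ τ₀ s ω) (dZ τ₀ s ω)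

theorem exists_mixedNorm_le_of_tendsto (hp : 1 ≤ p) (hq : 1 ≤ q)
    (hmeas : Measurable fun x : (ℝ × ℝ) × Ω => dZ x.1.1 x.1.2 x.2)
    (hfin : ∀ τ ∈ Icc S T,
      mixedNorm (volume.restrict (Icc S T)) P p q (fun s ω => ‖dZ τ s ω‖ₑ) < ⊤)
    (hcont : ∀ τ₀ ∈ Icc S T, Tendsto (fun τ => mixedNorm (volume.restrict (Icc S T)) P p q
      (fun s ω => ‖dZ τ s ω - dZ τ₀ s ω‖ₑ)) (𝓝[Icc S T] τ₀) (𝓝 0)) :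
    ∃ C < ⊤, ∀ τ ∈ Icc S T,
      mixedNorm (volume.restrict (Icc S T)) P p q (fun s ω => ‖dZ τ s ω‖ₑ) ≤ C := by
  refine isCompact_Icc.induction_on (p := fun A : Set ℝ => ∃ C < ⊤, ∀ τ ∈ A,
    mixedNorm (volume.restrict (Icc S T)) P p q (fun s ω => ‖dZ τ s ω‖ₑ) ≤ C)
    ⟨0, by simp⟩ ?_ ?_ ?_
  · rintro A B hAB ⟨C, hC, h⟩
    exact ⟨C, hC, fun τ hτ => h τ (hAB hτ)⟩
  · rintro A B ⟨C, hC, h⟩ ⟨C', hC', h'⟩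
    refine ⟨max C C', max_lt hC hC', ?_⟩
    rintro τ (hτ | hτ)
    · exact (h τ hτ).trans (le_max_left _ _)
    · exact (h' τ hτ).trans (le_max_right _ _)
  · intro τ₀ hτ₀
    refine ⟨_, (hcont τ₀ hτ₀).eventually (ge_mem_nhds zero_lt_one), _,
      ENNReal.add_lt_top.2 ⟨ENNReal.one_lt_top, hfin τ₀ hτ₀⟩, fun τ hτ => ?_⟩
    exact (mixedNorm_enorm_le_add hp hq _ hmeas τ τ₀).trans (add_le_add_left hτ _)

theorem lintegral_lintegral_enorm_derivative_lt_top [IsProbabilityMeasure P] (hp : 1 ≤ p) (hq : 1 ≤ q)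
    (hmeas : Measurable fun x : (ℝ × ℝ) × Ω => dZ x.1.1 x.1.2 x.2)
    (hfin : ∀ τ ∈ Icc S T,
      mixedNorm (volume.restrict (Icc S T)) P p q (fun s ω => ‖dZ τ s ω‖ₑ) < ⊤)
    (hcont : ∀ τ₀ ∈ Icc S T, Tendsto (fun τ => mixedNorm (volume.restrict (Icc S T)) P p q
      (fun s ω => ‖dZ τ s ω - dZ τ₀ s ω‖ₑ)) (𝓝[Icc S T] τ₀) (𝓝 0)) :
    ∫⁻ x, (∫⁻ τ in Icc S T, ‖dZ τ x.1 x.2‖ₑ) ∂((volume.restrict (Icc S T)).prod P) < ⊤ := by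
  obtain ⟨C, hC, hle⟩ := exists_mixedNorm_le_of_tendsto hp hq hmeas hfin hcont
  have hm : Measurable fun x : ℝ × Ω => ∫⁻ τ in Icc S T, ‖dZ τ x.1 x.2‖ₑ :=
    measurable_lintegral_enorm_derivative hmeas _
  rw [lintegral_prod_symm' _ hm,
    ← mixedNorm_one_one (f := fun s ω => ∫⁻ τ in Icc S T, ‖dZ τ s ω‖ₑ)]
  refine (mixedNorm_le_of_exponent_le one_pos hp one_pos hq hm).trans_lt ?_
  refine ENNReal.mul_lt_top (ENNReal.rpow_lt_top_of_nonneg ?_ (measure_lt_top _ _).ne) ?_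
  · exact sub_nonneg.2 (one_div_le_one_div_of_le one_pos hq)
  · refine (mixedNorm_lintegral_le _ hp hq hmeas.enorm).trans_lt ?_
    refine (setLIntegral_mono measurable_const hle).trans_lt ?_
    rw [setLIntegral_const]
    exact ENNReal.mul_lt_top hC (by simp)

variable [NormedSpace ℝ E] {Diag : ℝ → Ω → E}

/-- The diagonal process does not depend on the base point of the integral. -/
theorem ae_diag_eq_add_integral (hST : S ≤ T)
    (hmeas : Measurable fun x : (ℝ × ℝ) × Ω => dZ x.1.1 x.1.2 x.2)
    (hfin : ∫⁻ x, (∫⁻ τ in Icc S T, ‖dZ τ x.1 x.2‖ₑ) ∂((volume.restrict (Icc S T)).prod P) < ⊤)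
    (hFTC : ∀ t₁ ∈ Icc S T, ∀ t₂ ∈ Icc S T,
      ∀ᵐ x ∂((volume.restrict (Icc S T)).prod P),
        Z t₁ x.1 x.2 - Z t₂ x.1 x.2 = ∫ τ in t₂..t₁, dZ τ x.1 x.2)
    (hDiag : ∀ s ω, Diag s ω = Z S s ω + ∫ τ in S..s, dZ τ s ω) {t : ℝ} (ht : t ∈ Icc S T) :
    ∀ᵐ x ∂((volume.restrict (Icc S T)).prod P), x.1 ∈ Icc S T ∧
      Diag x.1 x.2 = Z t x.1 x.2 + ∫ τ in t..x.1, dZ τ x.1 x.2 := by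
  have hm : Measurable fun x : ℝ × Ω => ∫⁻ τ in Icc S T, ‖dZ τ x.1 x.2‖ₑ :=
    measurable_lintegral_enorm_derivative hmeas _
  have hmem : ∀ᵐ x ∂((volume.restrict (Icc S T)).prod P), x.1 ∈ Icc S T :=
    Measure.quasiMeasurePreserving_fst.ae (ae_restrict_mem measurableSet_Icc)
  filter_upwards [ae_lt_top hm hfin.ne, hmem, hFTC t ht S (left_mem_Icc.2 hST)] with x hx hxm hZ
  have hint : IntegrableOn (fun τ => dZ τ x.1 x.2) (Icc S T) :=
    ⟨(hmeas.comp (by fun_prop : Measurable fun τ : ℝ => ((τ, x.1), x.2))).aestronglyMeasurable, hx⟩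
  have hii {a b : ℝ} (ha : a ∈ Icc S T) (hb : b ∈ Icc S T) :
      IntervalIntegrable (fun τ => dZ τ x.1 x.2) volume a b :=
    (hint.mono_set (uIcc_subset_Icc ha hb)).intervalIntegrable
  refine ⟨hxm, ?_⟩
  rw [hDiag, ← intervalIntegral.integral_add_adjacent_intervals
    (hii (left_mem_Icc.2 hST) ht) (hii ht hxm), ← hZ]
  abel

theorem eventually_mixedNorm_sub_diag_le [IsProbabilityMeasure P] (hp : 1 ≤ p) (hq : 1 ≤ q)
    (hmeas : Measurable fun x : (ℝ × ℝ) × Ω => dZ x.1.1 x.1.2 x.2)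
    (hfin : ∀ τ ∈ Icc S T,
      mixedNorm (volume.restrict (Icc S T)) P p q (fun s ω => ‖dZ τ s ω‖ₑ) < ⊤)
    (hcont : ∀ τ₀ ∈ Icc S T, Tendsto (fun τ => mixedNorm (volume.restrict (Icc S T)) P p q
      (fun s ω => ‖dZ τ s ω - dZ τ₀ s ω‖ₑ)) (𝓝[Icc S T] τ₀) (𝓝 0))
    {t : ℝ} (ht : t ∈ Ico S T)
    (h : ∀ᵐ x ∂((volume.restrict (Icc S T)).prod P), x.1 ∈ Icc S T ∧
      Diag x.1 x.2 = Z t x.1 x.2 + ∫ τ in t..x.1, dZ τ x.1 x.2)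
    {p' q' : ℝ} (hp' : 1 ≤ p') (hpp : p' ≤ p) (hq' : 1 ≤ q') (hqq : q' ≤ q)
    {η : ℝ≥0∞} (hη : 0 < η) :
    ∀ᶠ ε : ℝ in 𝓝[>] 0, mixedNorm (volume.restrict (Icc t (t + ε))) P p' q'
      (fun s ω => ‖Z t s ω - Diag s ω‖ₑ) ≤ η * ENNReal.ofReal (ε ^ (1 + 1 / q' - 1 / q)) := by
  have hη2 : 0 < η / 2 := ENNReal.half_pos hη.ne'
  have htm : t ∈ Icc S T := Ico_subset_Icc_self ht
  have hm (σ : ℝ) : Measurable fun x : ℝ × Ω => dZ σ x.1 x.2 :=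
    hmeas.comp (by fun_prop : Measurable fun x : ℝ × Ω => ((σ, x.1), x.2))
  have hIcc {ε : ℝ} (hε : ε < T - t) : Icc t (t + ε) ⊆ Icc S T :=
    Icc_subset_Icc ht.1 (by linarith)
  have hcont' : ∀ᶠ ε : ℝ in 𝓝[>] 0, ∀ τ ∈ Icc t (t + ε),
      mixedNorm (volume.restrict (Icc S T)) P p q (fun s ω => ‖dZ τ s ω - dZ t s ω‖ₑ) ≤ η / 2 := by
    have h1 := (hcont t htm).eventually (ge_mem_nhds hη2)
    rw [eventually_nhdsWithin_iff, Metric.eventually_nhds_iff] at h1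
    obtain ⟨δ, hδ, h1⟩ := h1
    filter_upwards [Ioo_mem_nhdsGT hδ, Ioo_mem_nhdsGT (sub_pos.2 ht.2)] with ε hε hε' τ hτ
    refine h1 ?_ (hIcc hε'.2 hτ)
    rw [Real.dist_eq, abs_of_nonneg (by linarith [hτ.1])]
    linarith [hτ.2, hε.2]
  have hshrink : ∀ᶠ ε : ℝ in 𝓝[>] 0,
      mixedNorm (volume.restrict (Icc t (t + ε))) P p q (fun s ω => ‖dZ t s ω‖ₑ) ≤ η / 2 := by
    have hlim : Tendsto (fun ε : ℝ => volume.restrict (Icc S T) (Icc t (t + ε))) (𝓝[>] 0)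
        (𝓝 0) := by
      refine tendsto_of_tendsto_of_tendsto_of_le_of_le tendsto_const_nhds ?_
        (fun _ => zero_le) (fun ε => Measure.restrict_apply_le _ _)
      simp only [Real.volume_Icc, add_sub_cancel_left]
      exact tendsto_nhdsWithin_of_tendsto_nhds
        (ENNReal.continuous_ofReal.tendsto' _ _ ENNReal.ofReal_zero)
    have h1 := (tendsto_mixedNorm_restrict_zero (by linarith) (by linarith) (hm t).enorm
      (hfin t htm).ne hlim).eventually (ge_mem_nhds hη2)
    filter_upwards [h1, Ioo_mem_nhdsGT (sub_pos.2 ht.2)] with ε hε hε'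
    rwa [Measure.restrict_restrict measurableSet_Icc, inter_eq_left.2 (hIcc hε'.2)] at hε
  filter_upwards [hcont', hshrink, Ioo_mem_nhdsGT (sub_pos.2 ht.2)] with ε hc hs hε
  have hexp : 0 ≤ 1 / q' - 1 / q := sub_nonneg.2 (one_div_le_one_div_of_le (by linarith) hqq)
  have hε0 : 0 ≤ ε := hε.1.le
  calc mixedNorm (volume.restrict (Icc t (t + ε))) P p' q' (fun s ω => ‖Z t s ω - Diag s ω‖ₑ)
      ≤ mixedNorm (volume.restrict (Icc t (t + ε))) P p' q'
          (fun s ω => ∫⁻ τ in Icc t (t + ε), ‖dZ τ s ω‖ₑ) :=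
        mixedNorm_mono_ae (by linarith) (by linarith)
          (ae_enorm_sub_diag_le (left_mem_Icc.2 (by linarith)) (hIcc hε.2) h)
    _ ≤ ∫⁻ τ in Icc t (t + ε),
          mixedNorm (volume.restrict (Icc t (t + ε))) P p' q' (fun s ω => ‖dZ τ s ω‖ₑ) :=
        mixedNorm_lintegral_le _ hp' hq' hmeas.enorm
    _ ≤ ∫⁻ _ in Icc t (t + ε), ENNReal.ofReal ε ^ (1 / q' - 1 / q) * η := by
        refine setLIntegral_mono measurable_const fun τ hτ => ?_
        refine (mixedNorm_le_of_exponent_le (by linarith) hpp (by linarith) hqq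
          (hm τ).enorm).trans ?_
        rw [Measure.restrict_apply_univ, Real.volume_Icc, add_sub_cancel_left]
        gcongr
        refine (mixedNorm_enorm_le_add hp hq _ hmeas τ t).trans ?_
        rw [← ENNReal.add_halves η]
        refine add_le_add (le_trans ?_ (hc τ hτ)) hs
        exact mixedNorm_mono_measure (by linarith) (by linarith)
          (Measure.restrict_mono_set _ (hIcc hε.2)) _
    _ = η * ENNReal.ofReal (ε ^ (1 + 1 / q' - 1 / q)) := by
        rw [setLIntegral_const, Real.volume_Icc, add_sub_cancel_left,
          ENNReal.ofReal_rpow_of_nonneg hε0 hexp, mul_comm (ENNReal.ofReal _) η, mul_assoc,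
          ← ENNReal.ofReal_mul (by positivity), add_sub_assoc, Real.rpow_add hε.1, Real.rpow_one,
          mul_comm ε]

end FlowDerivative

section LpqNormOn

variable {Ω : Type*} [MeasurableSpace Ω] {P : Measure Ω} {n : ℕ}

theorem LpqNormOn_eq_mixedNorm (A : Set ℝ) (p q : ℝ)
    (z : ℝ → Ω → EuclideanSpace ℝ (Fin n)) :
    LpqNormOn P A p q z = mixedNorm (volume.restrict A) P p q (fun s ω => ‖z s ω‖ₑ) := by
  simp only [LpqNormOn, mixedNorm, eLpNorm'_eq_lintegral_enorm, enorm_eq_self, ofReal_norm,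
    ← ENNReal.rpow_mul, one_div_mul_eq_div]

end LpqNormOn

theorem measurable_intervalIntegral_prod {Ω E : Type*} [MeasurableSpace Ω] [NormedAddCommGroup E]
    [NormedSpace ℝ E] [MeasurableSpace E] [BorelSpace E] [SecondCountableTopology E]
    {f : ℝ → ℝ → Ω → E} (hf : Measurable fun x : (ℝ × ℝ) × Ω => f x.1.1 x.1.2 x.2) (a : ℝ) :
    Measurable fun x : ℝ × Ω => ∫ τ in a..x.1, f τ x.1 x.2 := by
  have hmeas : Measurable fun z : (ℝ × Ω) × ℝ => f z.2 z.1.1 z.1.2 :=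
    hf.comp (by fun_prop : Measurable fun z : (ℝ × Ω) × ℝ => ((z.2, z.1.1), z.1.2))
  have key (B : Set (ℝ × ℝ)) (hB : MeasurableSet B) :
      Measurable fun x : ℝ × Ω => ∫ τ, {τ | (τ, x.1) ∈ B}.indicator (fun τ => f τ x.1 x.2) τ := by
    have hind : Measurable ({z : (ℝ × Ω) × ℝ | (z.2, z.1.1) ∈ B}.indicator
        fun z => f z.2 z.1.1 z.1.2) :=
      hmeas.indicator ((by fun_prop : Measurable fun z : (ℝ × Ω) × ℝ => (z.2, z.1.1)) hB)
    exact hind.stronglyMeasurable.integral_prod_right'.measurable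
  have h1 := key {y | a < y.1 ∧ y.1 ≤ y.2}
    ((measurableSet_lt measurable_const measurable_fst).inter
      (measurableSet_le measurable_fst measurable_snd))
  have h2 := key {y | y.2 < y.1 ∧ y.1 ≤ a}
    ((measurableSet_lt measurable_snd measurable_fst).inter
      (measurableSet_le measurable_fst measurable_const))
  simp only [intervalIntegral, ← integral_indicator measurableSet_Ioc]
  exact h1.sub h2

/-- Stopping the time variable of a progressive process at `T` gives a jointly measurable
function. -/
theorem measurable_progressive_min {Ω E : Type*} {mΩ : MeasurableSpace Ω} [TopologicalSpace E]
    [TopologicalSpace.PseudoMetrizableSpace E] [MeasurableSpace E] [BorelSpace E]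
    {F : Filtration ℝ mΩ} {W : ℝ → Ω → E} (hW : IsStronglyProgressive F W) (T : ℝ) :
    Measurable fun x : ℝ × Ω => W (min x.1 T) x.2 := by
  have hle : (Subtype.instMeasurableSpace.prod (F T) : MeasurableSpace (Iic T × Ω)) ≤
      Subtype.instMeasurableSpace.prod mΩ :=
    sup_le_sup_left (MeasurableSpace.comap_mono (F.le T)) _
  have hT : Measurable fun y : Iic T × Ω => W y.1 y.2 := ((hW T).mono hle).measurable
  exact hT.comp (g := fun y : Iic T × Ω => W y.1 y.2)
    (f := fun x : ℝ × Ω => ((⟨min x.1 T, mem_Iic.2 (min_le_right x.1 T)⟩ : Iic T), x.2))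
    (((measurable_fst.min measurable_const).subtype_mk).prodMk measurable_snd)

theorem lintegral_lintegral_enorm_sub_le {α Ω E : Type*} [MeasurableSpace α] [MeasurableSpace Ω]
    [NormedAddCommGroup E] {μ : Measure α} [SFinite μ] {P : Measure Ω} (U V X : α → Ω → E)
    (h : Measurable fun x : α × Ω => ‖V x.1 x.2 - X x.1 x.2‖ₑ) :
    ∫⁻ ω, ∫⁻ s, ‖U s ω - X s ω‖ₑ ∂μ ∂P ≤
      (∫⁻ ω, ∫⁻ s, ‖U s ω - V s ω‖ₑ ∂μ ∂P) + ∫⁻ ω, ∫⁻ s, ‖V s ω - X s ω‖ₑ ∂μ ∂P := by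
  have hω (ω : Ω) : Measurable fun s => ‖V s ω - X s ω‖ₑ := h.comp measurable_prodMk_right
  have hint : Measurable fun ω => ∫⁻ s, ‖V s ω - X s ω‖ₑ ∂μ := h.lintegral_prod_left'
  rw [← lintegral_add_right _ hint]
  refine lintegral_mono fun ω => ?_
  rw [← lintegral_add_right _ (hω ω)]
  refine lintegral_mono fun s => ?_
  simpa using enorm_add_le (U s ω - V s ω) (V s ω - X s ω)

/-- A progressive process whose right averages of the distance to a measurable process `X` vanish
in the limit coincides with `X` almost everywhere. -/
theorem ae_eq_of_tendsto_right_average {Ω E : Type*} {mΩ : MeasurableSpace Ω} {P : Measure Ω}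
    [SFinite P] [NormedAddCommGroup E] [MeasurableSpace E] [BorelSpace E]
    [SecondCountableTopology E] {F : Filtration ℝ mΩ} {S T : ℝ} (hST : S ≤ T) {W X : ℝ → Ω → E}
    (hW : IsStronglyProgressive F W) (hX : Measurable fun x : ℝ × Ω => X x.1 x.2)
    (hfin : ∫⁻ ω, ∫⁻ s in Icc S T, ‖W s ω - X s ω‖ₑ ∂volume ∂P ≠ ⊤)
    (hlim : ∀ t ∈ Ico S T, Tendsto (fun ε : ℝ => (ENNReal.ofReal ε)⁻¹ *
      ∫⁻ ω, ∫⁻ s in Icc t (t + ε), ‖W s ω - X s ω‖ₑ ∂volume ∂P) (𝓝[>] 0) (𝓝 0)) :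
    ∀ᵐ x ∂((volume.restrict (Icc S T)).prod P), W x.1 x.2 = X x.1 x.2 := by
  have hgm : Measurable fun x : ℝ × Ω => ‖W (min x.1 T) x.2 - X x.1 x.2‖ₑ :=
    ((measurable_progressive_min hW T).sub hX).enorm
  have hswap {a b : ℝ} (hb : b ≤ T) :
      ∫⁻ s in Icc a b, (∫⁻ ω, ‖W (min s T) ω - X s ω‖ₑ ∂P) =
        ∫⁻ ω, ∫⁻ s in Icc a b, ‖W s ω - X s ω‖ₑ ∂volume ∂P := by
    rw [lintegral_lintegral_swap hgm.aemeasurable]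
    refine lintegral_congr fun ω => setLIntegral_congr_fun measurableSet_Icc fun s hs => ?_
    simp only [min_eq_left (hs.2.trans hb)]
  have hnull : ∫⁻ s in Icc S T, (∫⁻ ω, ‖W (min s T) ω - X s ω‖ₑ ∂P) = 0 := by
    refine setLIntegral_eq_zero_of_tendsto_right_average hgm.lintegral_prod_right' hST ?_ ?_
    · rwa [hswap le_rfl]
    · intro t ht
      refine (hlim t ht).congr' ?_
      filter_upwards [Ioo_mem_nhdsGT (sub_pos.2 ht.2)] with ε hε
      rw [hswap (by linarith [hε.2])]
  rw [← lintegral_prod _ hgm.aemeasurable, lintegral_eq_zero_iff hgm] at hnull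
  have hmem : ∀ᵐ x ∂((volume.restrict (Icc S T)).prod P), x.1 ∈ Icc S T :=
    Measure.quasiMeasurePreserving_fst.ae (ae_restrict_mem measurableSet_Icc)
  filter_upwards [hnull, hmem] with x hx hxm
  simpa [min_eq_left hxm.2, sub_eq_zero] using hx

/-- Lemma 2.6 (ii) of the paper: with `Z ∈ C¹([S,T];L^{p,q}_F(S,T;H))` and
`Diag[Z](s) = Z(S,s) + ∫_S^s ∂_t Z(τ,s) dτ`, for all `1 ≤ p' ≤ p`, `1 ≤ q' ≤ q` and
`t ∈ [S,T)` one has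
`E[(∫_t^{t+ε}|Z(t,s) − Diag[Z](s)|^{q'} ds)^{p'/q'}]^{1/p'} = o(ε^{1+1/q'−1/q})`;
in particular `Diag[Z]` satisfies Property (D) with respect to `Z`, and it is the unique
process with this property. -/
theorem stmt7 {Ω : Type*} {mΩ : MeasurableSpace Ω} (P : Measure Ω) [IsProbabilityMeasure P]
    (F : MeasureTheory.Filtration ℝ mΩ)
    {n : ℕ} (S T p q : ℝ) (hS : 0 ≤ S) (hST : S < T) (hp : 1 ≤ p) (hq : 1 ≤ q)
    (Z dZ : ℝ → ℝ → Ω → EuclideanSpace ℝ (Fin n))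
    (hZmeas : Measurable (fun x : (ℝ × ℝ) × Ω => Z x.1.1 x.1.2 x.2))
    (hdZmeas : Measurable (fun x : (ℝ × ℝ) × Ω => dZ x.1.1 x.1.2 x.2))
    (hZprog : ∀ t, ProgMeasurable F (Z t))
    (hdZprog : ∀ τ, ProgMeasurable F (dZ τ))
    (hZint : ∀ t ∈ Icc S T, LpqNormOn P (Icc S T) p q (Z t) < ⊤)
    (hdZint : ∀ τ ∈ Icc S T, LpqNormOn P (Icc S T) p q (dZ τ) < ⊤)
    (hFTC : ∀ t₁ ∈ Icc S T, ∀ t₂ ∈ Icc S T,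
      ∀ᵐ x ∂((volume.restrict (Icc S T)).prod P),
        Z t₁ x.1 x.2 - Z t₂ x.1 x.2 = ∫ τ in t₂..t₁, dZ τ x.1 x.2)
    (hdZcont : ∀ τ₀ ∈ Icc S T,
      Tendsto (fun τ => LpqNormOn P (Icc S T) p q (fun s ω => dZ τ s ω - dZ τ₀ s ω))
        (𝓝[Icc S T] τ₀) (𝓝 0))
    (Diag : ℝ → Ω → EuclideanSpace ℝ (Fin n))
    (hDiag : ∀ s ω, Diag s ω = Z S s ω + ∫ τ in S..s, dZ τ s ω) :
    -- the `o(ε^{1+1/q'-1/q})` estimate: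
    (∀ p' q' : ℝ, 1 ≤ p' → p' ≤ p → 1 ≤ q' → q' ≤ q → ∀ t ∈ Ico S T,
      Tendsto (fun ε : ℝ =>
          LpqNormOn P (Icc t (t + ε)) p' q' (fun s ω => Z t s ω - Diag s ω) /
            ENNReal.ofReal (ε ^ (1 + 1/q' - 1/q)))
        (𝓝[>] (0:ℝ)) (𝓝 0)) ∧
    -- `Diag[Z]` satisfies Property (D) with respect to `Z`:
    (∀ t ∈ Ico S T,
      Tendsto (fun ε : ℝ =>
          (ENNReal.ofReal ε)⁻¹ *
            ∫⁻ ω, ∫⁻ s in Icc t (t + ε), ENNReal.ofReal ‖Z t s ω - Diag s ω‖ ∂volume ∂P)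
        (𝓝[>] (0:ℝ)) (𝓝 0)) ∧
    -- uniqueness: any other process satisfying Property (D) agrees with `Diag[Z]` a.e.:
    (∀ W : ℝ → Ω → EuclideanSpace ℝ (Fin n), ProgMeasurable F W →
      (∫⁻ ω, ∫⁻ s in Icc S T, ENNReal.ofReal ‖W s ω‖ ∂volume ∂P) < ⊤ →
      (∀ t ∈ Ico S T,
        Tendsto (fun ε : ℝ =>
            (ENNReal.ofReal ε)⁻¹ *
              ∫⁻ ω, ∫⁻ s in Icc t (t + ε), ENNReal.ofReal ‖Z t s ω - W s ω‖ ∂volume ∂P)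
          (𝓝[>] (0:ℝ)) (𝓝 0)) →
      ∀ᵐ x ∂((volume.restrict (Icc S T)).prod P), W x.1 x.2 = Diag x.1 x.2) := by
  have hqpos : 0 < q := by linarith
  simp only [LpqNormOn_eq_mixedNorm] at hZint hdZint hdZcont
  have hfin := lintegral_lintegral_enorm_derivative_lt_top hp hq hdZmeas hdZint hdZcont
  have hdiag {t : ℝ} (ht : t ∈ Icc S T) :=
    ae_diag_eq_add_integral hST.le hdZmeas hfin hFTC hDiag ht
  have hbound {p' q' : ℝ} (hp' : 1 ≤ p') (hpp : p' ≤ p) (hq' : 1 ≤ q') (hqq : q' ≤ q) {t : ℝ}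
      (ht : t ∈ Ico S T) {η : ℝ≥0∞} (hη : 0 < η) :=
    eventually_mixedNorm_sub_diag_le hp hq hdZmeas hdZint hdZcont ht
      (hdiag (Ico_subset_Icc_self ht)) hp' hpp hq' hqq hη
  have hD : ∀ t ∈ Ico S T, Tendsto (fun ε : ℝ => (ENNReal.ofReal ε)⁻¹ *
      ∫⁻ ω, ∫⁻ s in Icc t (t + ε), ENNReal.ofReal ‖Z t s ω - Diag s ω‖ ∂volume ∂P)
      (𝓝[>] (0:ℝ)) (𝓝 0) := by
    intro t ht
    refine ENNReal.tendsto_nhds_zero.2 fun η hη => ?_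
    filter_upwards [hbound le_rfl hp le_rfl hq ht hη, Ioo_mem_nhdsGT one_pos] with ε hε hε1
    simp only [mixedNorm_one_one] at hε
    simp only [ofReal_norm]
    rw [mul_comm, ← div_eq_mul_inv]
    refine ENNReal.div_le_of_le_mul (hε.trans ?_)
    gcongr
    refine Real.rpow_le_self_of_le_one hε1.1.le hε1.2.le ?_
    have : 1 / q ≤ 1 := by rw [div_le_one hqpos]; exact hq
    linarith
  refine ⟨?_, hD, ?_⟩
  · intro p' q' hp' hpp hq' hqq t ht
    refine ENNReal.tendsto_nhds_zero.2 fun η hη => ?_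
    filter_upwards [hbound hp' hpp hq' hqq ht hη] with ε hε
    rw [LpqNormOn_eq_mixedNorm]
    exact ENNReal.div_le_of_le_mul hε
  · intro W hW hWint hWD
    have hS' : S ∈ Icc S T := left_mem_Icc.2 hST.le
    have hZm (t : ℝ) : Measurable fun x : ℝ × Ω => Z t x.1 x.2 :=
      hZmeas.comp (by fun_prop : Measurable fun x : ℝ × Ω => ((t, x.1), x.2))
    have hDm : Measurable fun x : ℝ × Ω => Diag x.1 x.2 := by
      simp only [hDiag]
      exact (hZm S).add (measurable_intervalIntegral_prod hdZmeas S)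
    have hZDm (t : ℝ) : Measurable fun x : ℝ × Ω => ‖Z t x.1 x.2 - Diag x.1 x.2‖ₑ :=
      ((hZm t).sub hDm).enorm
    simp only [ofReal_norm] at hWint hWD hD
    refine ae_eq_of_tendsto_right_average hST.le hW hDm ?_ fun t ht => ?_
    · have hZ1 : ∫⁻ ω, ∫⁻ s in Icc S T, ‖0 - Z S s ω‖ₑ ∂volume ∂P < ⊤ := by
        simp only [zero_sub, enorm_neg]
        rw [← mixedNorm_one_one (f := fun s ω => ‖Z S s ω‖ₑ)]
        refine (mixedNorm_le_of_exponent_le one_pos hp one_pos hq (hZm S).enorm).trans_lt ?_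
        refine ENNReal.mul_lt_top
          (ENNReal.rpow_lt_top_of_nonneg ?_ (measure_lt_top _ _).ne) (hZint S hS')
        exact sub_nonneg.2 (one_div_le_one_div_of_le one_pos hq)
      have hZD : ∫⁻ ω, ∫⁻ s in Icc S T, ‖Z S s ω - Diag s ω‖ₑ ∂volume ∂P < ⊤ := by
        have hdm : Measurable fun x : ℝ × Ω => ∫⁻ τ in Icc S T, ‖dZ τ x.1 x.2‖ₑ :=
          measurable_lintegral_enorm_derivative hdZmeas _
        rw [lintegral_prod_symm' _ hdm] at hfin
        refine (lintegral_mono_ae ?_).trans_lt hfin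
        filter_upwards [ae_enorm_sub_diag_le hS' subset_rfl (hdiag hS')] with ω hω
        exact lintegral_mono_ae hω
      have hWZ : ∫⁻ ω, ∫⁻ s in Icc S T, ‖W s ω - Z S s ω‖ₑ ∂volume ∂P < ⊤ := by
        refine (lintegral_lintegral_enorm_sub_le W (fun _ _ => 0) (Z S)
          (measurable_const.sub (hZm S)).enorm).trans_lt ?_
        simp only [sub_zero]
        exact ENNReal.add_lt_top.2 ⟨hWint, hZ1⟩
      exact ((lintegral_lintegral_enorm_sub_le W (Z S) Diag (hZDm S)).trans_lt
        (ENNReal.add_lt_top.2 ⟨hWZ, hZD⟩)).ne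
    · have hsum := (hWD t ht).add (hD t ht)
      rw [add_zero] at hsum
      refine tendsto_of_tendsto_of_tendsto_of_le_of_le tendsto_const_nhds hsum
        (fun _ => zero_le) fun ε => ?_
      rw [← mul_add]
      gcongr
      simp only [enorm_sub_rev (Z t _ _) (W _ _)]
      exact lintegral_lintegral_enorm_sub_le W (Z t) Diag (hZDm t)
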